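/- Let Γ be an infinite finitely generated amenable group with polynomial growth of order d (a·n^d ≤ V(n) ≤ b·n^d), and H the combinatorial Laplacian on a Cayley graph of Γ with integrated density of states N_per(E) = ⟨δ_ι, χ_{(−∞,E]}(H) δ_ι⟩. Then lim_{E↘0} ln N_per(E) / ln E = d/2. -/

import Mathlib

open scoped BigOperators Classical Topology
open Filter MeasureTheory

noncomputable section

/-- The Cayley graph of a group with respect to a (symmetric) finite generating set `S`. -/
def cayleyGraph {Γ : Type*} [Group Γ] (S : Finset Γ) : SimpleGraph Γ :=
  SimpleGraph.fromRel fun x y => x⁻¹ * y ∈ S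

/-- The combinatorial Laplacian `H = k·Id − A` of the Cayley graph with generating set `S`,
acting on functions `Γ → ℝ`:  `(H f) x = |S|·f x − ∑_{s ∈ S} f (x·s)`. -/
def lapOp {Γ : Type*} [Group Γ] (S : Finset Γ) (f : Γ → ℝ) : Γ → ℝ :=
  fun x => (S.card : ℝ) * f x - ∑ s ∈ S, f (x * s)

section CayleyGeometry

variable {Γ : Type*} [Group Γ] {S : Finset Γ}

lemma cayleyGraph_adj_iff (hSsym : ∀ s ∈ S, s⁻¹ ∈ S) {x y : Γ} :
    (cayleyGraph S).Adj x y ↔ x ≠ y ∧ x⁻¹ * y ∈ S := by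
  rw [cayleyGraph, SimpleGraph.fromRel_adj]
  refine and_congr_right fun _ => ⟨?_, Or.inl⟩
  rintro (h | h)
  · exact h
  · simpa using hSsym _ h

lemma cayleyGraph_adj_mul (hS1 : (1 : Γ) ∉ S) (hSsym : ∀ s ∈ S, s⁻¹ ∈ S) (x : Γ) {s : Γ}
    (hs : s ∈ S) : (cayleyGraph S).Adj x (x * s) := by
  rw [cayleyGraph_adj_iff hSsym]
  refine ⟨fun h => hS1 ?_, by simpa⟩
  rw [left_eq_mul] at h
  rwa [h] at hs

lemma cayleyGraph_connected (hS1 : (1 : Γ) ∉ S) (hSsym : ∀ s ∈ S, s⁻¹ ∈ S)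
    (hgen : Subgroup.closure (S : Set Γ) = ⊤) : (cayleyGraph S).Connected := by
  have key : ∀ x : Γ, (cayleyGraph S).Reachable 1 x := by
    intro x
    have hx : x ∈ Subgroup.closure (S : Set Γ) := hgen ▸ Subgroup.mem_top x
    induction hx using Subgroup.closure_induction_right with
    | one => exact SimpleGraph.Reachable.refl _
    | mul_right x hx y hy ih => exact ih.trans (cayleyGraph_adj_mul hS1 hSsym x hy).reachable
    | mul_inv_cancel x hx y hy ih =>
      exact ih.trans (cayleyGraph_adj_mul hS1 hSsym x (hSsym y hy)).reachable
  exact ⟨fun x y => (key x).symm.trans (key y)⟩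

lemma dist_one_le_dist_one_mul (hS1 : (1 : Γ) ∉ S) (hSsym : ∀ s ∈ S, s⁻¹ ∈ S)
    (hgen : Subgroup.closure (S : Set Γ) = ⊤) (x : Γ) {s : Γ} (hs : s ∈ S) :
    (cayleyGraph S).dist 1 x ≤ (cayleyGraph S).dist 1 (x * s) + 1 := by
  have h := (cayleyGraph_connected hS1 hSsym hgen).dist_triangle (u := 1) (v := x * s) (w := x)
  rwa [SimpleGraph.dist_comm (u := x * s),
    SimpleGraph.dist_eq_one_iff_adj.2 (cayleyGraph_adj_mul hS1 hSsym x hs)] at h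

end CayleyGeometry

section EllTwo

open MonoidAlgebra

variable {Γ : Type*}

/-- The embedding of the group algebra into `ℓ²`. -/
def toL2 : MonoidAlgebra ℝ Γ →ₗ[ℝ] lp (fun _ : Γ => ℝ) 2 where
  toFun f := ⟨fun x => f.coeff x, memℓp_gen (summable_of_hasFiniteSupport
    (f.coeff.hasFiniteSupport.subset fun x hx => by
      contrapose! hx
      simp_all))⟩
  map_add' _ _ := rfl
  map_smul' _ _ := rfl

lemma toL2_apply (f : MonoidAlgebra ℝ Γ) (x : Γ) : toL2 f x = f.coeff x := rfl

lemma inner_toL2 (f g : MonoidAlgebra ℝ Γ) :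
    inner ℝ (toL2 f) (toL2 g) = f.coeff.sum fun x c => c * g.coeff x := by
  rw [lp.inner_eq_tsum, Finsupp.sum, tsum_eq_sum (s := f.coeff.support)]
  · simp [toL2_apply, mul_comm]
  · intro x hx
    simp_all [toL2_apply]

lemma norm_toL2_sq (f : MonoidAlgebra ℝ Γ) :
    ‖toL2 f‖ ^ 2 = f.coeff.sum fun _ c => c ^ 2 := by
  rw [← real_inner_self_eq_norm_sq, inner_toL2]
  simp [Finsupp.sum, sq]

end EllTwo

section LaplacianElement

open MonoidAlgebra
open Polynomial (aeval aeval_eq_sum_range aeval_algHom_apply coe_aeval_eq_eval)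
open scoped Polynomial

variable {Γ : Type*} [Group Γ] {S : Finset Γ}

/-- The combinatorial Laplacian as an element of the group algebra. -/
def lapElt (S : Finset Γ) : MonoidAlgebra ℝ Γ :=
  (S.card : ℝ) • 1 - ∑ s ∈ S, single s 1

lemma coeff_mul_lapElt (hSsym : ∀ s ∈ S, s⁻¹ ∈ S) (f : MonoidAlgebra ℝ Γ) (x : Γ) :
    (f * lapElt S).coeff x = S.card * f.coeff x - ∑ s ∈ S, f.coeff (x * s) := by
  simp only [lapElt, mul_sub, mul_smul_comm, mul_one, Finset.mul_sum, coeff_sub, coeff_smul,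
    coeff_sum, Finsupp.sub_apply, Finsupp.smul_apply, smul_eq_mul, Finsupp.finsetSum_apply,
    coeff_mul_single_apply]
  congr 1
  exact Finset.sum_nbij' (fun s => s⁻¹) (fun s => s⁻¹) hSsym hSsym (by simp) (by simp) (by simp)

lemma coeff_lapElt_mul (hSsym : ∀ s ∈ S, s⁻¹ ∈ S) (f : MonoidAlgebra ℝ Γ) (x : Γ) :
    (lapElt S * f).coeff x = S.card * f.coeff x - ∑ s ∈ S, f.coeff (s * x) := by
  simp only [lapElt, sub_mul, smul_mul_assoc, one_mul, Finset.sum_mul, coeff_sub, coeff_smul,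
    coeff_sum, Finsupp.sub_apply, Finsupp.smul_apply, smul_eq_mul, Finsupp.finsetSum_apply,
    coeff_single_mul_apply]
  congr 1
  exact Finset.sum_nbij' (fun s => s⁻¹) (fun s => s⁻¹) hSsym hSsym (by simp) (by simp) (by simp)

lemma lapOp_iterate_eq_coeff (hSsym : ∀ s ∈ S, s⁻¹ ∈ S) (j : ℕ) :
    (lapOp S)^[j] (fun x => if x = (1 : Γ) then 1 else 0) = ⇑(lapElt S ^ j).coeff := by
  induction j with
  | zero =>
    ext x
    simp [one_def, Finsupp.single_apply, eq_comm]
  | succ j ih =>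
    ext x
    rw [Function.iterate_succ_apply', ih, pow_succ, coeff_mul_lapElt hSsym]
    rfl

lemma coeff_lapElt_pow_inv (hSsym : ∀ s ∈ S, s⁻¹ ∈ S) (j : ℕ) (x : Γ) :
    (lapElt S ^ j).coeff x⁻¹ = (lapElt S ^ j).coeff x := by
  induction j generalizing x with
  | zero => simp [one_def, Finsupp.single_apply, eq_comm]
  | succ j ih =>
    rw [pow_succ, coeff_mul_lapElt hSsym, ← pow_succ, pow_succ', coeff_lapElt_mul hSsym, ih]
    congr 1
    refine Finset.sum_nbij' (fun s => s⁻¹) (fun s => s⁻¹) hSsym hSsym (by simp) (by simp) ?_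
    intro s _
    rw [← ih]
    simp

lemma coeff_aeval_lapElt_inv (hSsym : ∀ s ∈ S, s⁻¹ ∈ S) (q : ℝ[X]) (x : Γ) :
    (aeval (lapElt S) q).coeff x⁻¹ = (aeval (lapElt S) q).coeff x := by
  simp [aeval_eq_sum_range, coeff_sum, coeff_lapElt_pow_inv hSsym]

lemma coeff_lapElt_pow_of_lt_dist (hS1 : (1 : Γ) ∉ S) (hSsym : ∀ s ∈ S, s⁻¹ ∈ S)
    (hgen : Subgroup.closure (S : Set Γ) = ⊤) (j : ℕ) (x : Γ)
    (hx : j < (cayleyGraph S).dist 1 x) : (lapElt S ^ j).coeff x = 0 := by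
  induction j generalizing x with
  | zero =>
    have : x ≠ 1 := by rintro rfl; simp at hx
    simp [one_def, this.symm]
  | succ j ih =>
    rw [pow_succ, coeff_mul_lapElt hSsym, ih x (by lia), Finset.sum_eq_zero]
    · simp
    · intro s hs
      have := dist_one_le_dist_one_mul hS1 hSsym hgen x hs
      exact ih _ (by lia)

lemma coeff_aeval_lapElt_of_lt_dist (hS1 : (1 : Γ) ∉ S) (hSsym : ∀ s ∈ S, s⁻¹ ∈ S)
    (hgen : Subgroup.closure (S : Set Γ) = ⊤) (q : ℝ[X]) (x : Γ)
    (hx : q.natDegree < (cayleyGraph S).dist 1 x) : (aeval (lapElt S) q).coeff x = 0 := by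
  simp only [aeval_eq_sum_range, coeff_sum, Finsupp.finsetSum_apply, coeff_smul,
    Finsupp.smul_apply]
  refine Finset.sum_eq_zero fun i hi => ?_
  rw [coeff_lapElt_pow_of_lt_dist hS1 hSsym hgen i x (by grind), smul_zero]

lemma sum_coeff_aeval_lapElt (q : ℝ[X]) :
    ((aeval (lapElt S) q).coeff.sum fun _ c => c) = q.eval 0 := by
  let ε : MonoidAlgebra ℝ Γ →ₐ[ℝ] ℝ := MonoidAlgebra.lift ℝ ℝ Γ 1
  have h0 : ε (lapElt S) = 0 := by simp [ε, lapElt]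
  have h1 : ε (aeval (lapElt S) q) = q.eval 0 := by
    rw [← aeval_algHom_apply, h0, coe_aeval_eq_eval]
  rw [← h1]
  simp [ε, MonoidAlgebra.lift_apply]

/-- Multiplication by a symmetric element, evaluated at the identity, is the `ℓ²` pairing. -/
lemma coeff_mul_one_of_symm (f g : MonoidAlgebra ℝ Γ) (hg : ∀ x, g.coeff x⁻¹ = g.coeff x) :
    (f * g).coeff 1 = f.coeff.sum fun x c => c * g.coeff x := by
  simp [coeff_mul_apply_left, hg]

lemma norm_toL2_mul_single (f : MonoidAlgebra ℝ Γ) (y : Γ) :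
    ‖toL2 (f * single y 1)‖ = ‖toL2 f‖ := by
  rw [← sq_eq_sq₀ (norm_nonneg _) (norm_nonneg _), ← real_inner_self_eq_norm_sq,
    ← real_inner_self_eq_norm_sq, lp.inner_eq_tsum, lp.inner_eq_tsum]
  simpa [toL2_apply, coeff_mul_single_apply] using
    (Equiv.mulRight y⁻¹).tsum_eq (fun x => f.coeff x ^ 2)

lemma norm_toL2_single_mul (f : MonoidAlgebra ℝ Γ) (y : Γ) :
    ‖toL2 (single y 1 * f)‖ = ‖toL2 f‖ := by
  rw [← sq_eq_sq₀ (norm_nonneg _) (norm_nonneg _), ← real_inner_self_eq_norm_sq,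
    ← real_inner_self_eq_norm_sq, lp.inner_eq_tsum, lp.inner_eq_tsum]
  simpa [toL2_apply, coeff_single_mul_apply] using
    (Equiv.mulLeft y⁻¹).tsum_eq (fun x => f.coeff x ^ 2)

end LaplacianElement

section SpectralBounds

open MonoidAlgebra
open Polynomial (aeval)
open scoped Polynomial

variable {Γ : Type*} [Group Γ] {S : Finset Γ}

lemma norm_toL2_aeval_sq (hSsym : ∀ s ∈ S, s⁻¹ ∈ S) (q : ℝ[X]) :
    ‖toL2 (aeval (lapElt S) q)‖ ^ 2 = (aeval (lapElt S) (q ^ 2)).coeff 1 := by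
  rw [← real_inner_self_eq_norm_sq, inner_toL2, sq, map_mul,
    coeff_mul_one_of_symm _ _ (coeff_aeval_lapElt_inv hSsym q)]

lemma eval_zero_sq_le (hS1 : (1 : Γ) ∉ S) (hSsym : ∀ s ∈ S, s⁻¹ ∈ S)
    (hgen : Subgroup.closure (S : Set Γ) = ⊤) {n : ℕ}
    (hfin : {x : Γ | (cayleyGraph S).dist 1 x ≤ n}.Finite) (q : ℝ[X]) (hq : q.natDegree ≤ n) :
    q.eval 0 ^ 2 ≤ Nat.card {x : Γ | (cayleyGraph S).dist 1 x ≤ n} *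
      (aeval (lapElt S) (q ^ 2)).coeff 1 := by
  set f := aeval (lapElt S) q with hf
  have hsub : f.coeff.support ⊆ hfin.toFinset := by
    intro x hx
    rw [Set.Finite.mem_toFinset, Set.mem_ofPred_eq]
    by_contra! h
    exact Finsupp.mem_support_iff.1 hx
      (coeff_aeval_lapElt_of_lt_dist hS1 hSsym hgen q x (by lia))
  rw [← norm_toL2_aeval_sq hSsym, norm_toL2_sq, ← sum_coeff_aeval_lapElt (S := S), ← hf,
    Finsupp.sum, Finsupp.sum, Nat.card_coe_set_eq, Set.ncard_eq_toFinset_card _ hfin]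
  refine sq_sum_le_card_mul_sum_sq.trans ?_
  gcongr

lemma sum_norm_toL2_sub_sq (S : Finset Γ) (f : MonoidAlgebra ℝ Γ) :
    ∑ s ∈ S, ‖toL2 (f - f * single s 1)‖ ^ 2 =
      2 * inner ℝ (toL2 (f * lapElt S)) (toL2 f) := by
  have h : ∀ s ∈ S, ‖toL2 (f - f * single s 1)‖ ^ 2 =
      2 * inner ℝ (toL2 f - toL2 (f * single s 1)) (toL2 f) := by
    intro s _
    rw [map_sub, norm_sub_sq_real, norm_toL2_mul_single, inner_sub_left,
      real_inner_self_eq_norm_sq, real_inner_comm]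
    ring
  rw [Finset.sum_congr rfl h, ← Finset.mul_sum, ← sum_inner]
  congr 3
  rw [lapElt, mul_sub, mul_smul_comm, mul_one, Finset.mul_sum, map_sub, map_smul, map_sum,
    Finset.sum_sub_distrib, Finset.sum_const, Nat.cast_smul_eq_nsmul]

lemma norm_toL2_sub_mul_single_le (hSsym : ∀ s ∈ S, s⁻¹ ∈ S) (f : MonoidAlgebra ℝ Γ) {u v : Γ}
    (p : (cayleyGraph S).Walk u v) :
    ‖toL2 (f - f * single (u⁻¹ * v) 1)‖ ≤
      p.length * √(2 * inner ℝ (toL2 (f * lapElt S)) (toL2 f)) := by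
  induction p with
  | nil => simp [← one_def]
  | @cons u w v hadj p ih =>
    have hs : u⁻¹ * w ∈ S := ((cayleyGraph_adj_iff hSsym).1 hadj).2
    have hstep : ‖toL2 (f - f * single (u⁻¹ * w) 1)‖ ≤
        √(2 * inner ℝ (toL2 (f * lapElt S)) (toL2 f)) := by
      rw [← sum_norm_toL2_sub_sq S]
      exact Real.le_sqrt_of_sq_le (Finset.single_le_sum
        (f := fun s => ‖toL2 (f - f * single s 1)‖ ^ 2) (fun _ _ => by positivity) hs)
    have hsplit : f - f * single (u⁻¹ * v) 1 = (f - f * single (w⁻¹ * v) 1) +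
        (f - f * single (u⁻¹ * w) 1) * single (w⁻¹ * v) 1 := by
      rw [sub_mul, mul_assoc f, single_mul_single, mul_one, ← mul_assoc, mul_assoc u⁻¹,
        mul_inv_cancel, mul_one]
      abel
    rw [hsplit, map_add]
    refine (norm_add_le _ _).trans ?_
    rw [norm_toL2_mul_single, SimpleGraph.Walk.length_cons]
    push_cast
    linarith

lemma norm_toL2_sub_mul_average_le (f : MonoidAlgebra ℝ Γ) {B : Finset Γ} (hB : B.Nonempty)
    {M : ℝ} (hM : ∀ y ∈ B, ‖toL2 (f - f * single y 1)‖ ≤ M) :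
    ‖toL2 (f - f * ((B.card : ℝ)⁻¹ • ∑ y ∈ B, single y 1))‖ ≤ M := by
  have hpos : (0 : ℝ) < B.card := by exact_mod_cast hB.card_pos
  have h : f - f * ((B.card : ℝ)⁻¹ • ∑ y ∈ B, single y 1) =
      (B.card : ℝ)⁻¹ • ∑ y ∈ B, (f - f * single y 1) := by
    rw [Finset.sum_sub_distrib, Finset.sum_const, smul_sub, ← Nat.cast_smul_eq_nsmul ℝ,
      inv_smul_smul₀ hpos.ne', mul_smul_comm, Finset.mul_sum]
  rw [h, map_smul, norm_smul, map_sum, norm_inv, Real.norm_natCast, inv_mul_le_iff₀ hpos]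
  exact (norm_sum_le_of_le _ hM).trans (by simp)

lemma norm_toL2_average_sq {B : Finset Γ} (hB : B.Nonempty) :
    ‖toL2 ((B.card : ℝ)⁻¹ • ∑ y ∈ B, single y 1)‖ ^ 2 = (B.card : ℝ)⁻¹ := by
  have hpos : (0 : ℝ) < B.card := by exact_mod_cast hB.card_pos
  have h : ‖toL2 (∑ y ∈ B, single y 1)‖ ^ 2 = B.card := by
    have hc : ∀ x, (∑ y ∈ B, single y (1 : ℝ)).coeff x = if x ∈ B then 1 else 0 := by
      intro x
      simp [coeff_sum, Finsupp.single_apply]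
    rw [norm_toL2_sq, Finsupp.sum_of_support_subset (s := B)]
    · rw [Finset.sum_congr rfl fun x hx => by rw [hc, if_pos hx, one_pow]]
      simp
    · intro x hx
      rw [Finsupp.mem_support_iff, hc] at hx
      exact of_not_not fun h => hx (if_neg h)
    · simp
  rw [map_smul, norm_smul, mul_pow, h, norm_inv, Real.norm_natCast]
  field_simp

lemma norm_toL2_lazy_mul_le (hSne : S.Nonempty) (g : MonoidAlgebra ℝ Γ) :
    ‖toL2 ((1 - (2 * S.card : ℝ)⁻¹ • lapElt S) * g)‖ ≤ ‖toL2 g‖ := by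
  have hpos : (0 : ℝ) < S.card := by exact_mod_cast hSne.card_pos
  have h : (1 - (2 * S.card : ℝ)⁻¹ • lapElt S) * g =
      (2 * S.card : ℝ)⁻¹ • ∑ s ∈ S, (g + single s 1 * g) := by
    have h1 : (2 * S.card : ℝ)⁻¹ • ((S.card : ℝ) • g) + (2 * S.card : ℝ)⁻¹ • ((S.card : ℝ) • g)
        = g := by
      rw [smul_smul, ← add_smul]
      convert one_smul ℝ g
      field_simp
      norm_num
    rw [Finset.sum_add_distrib, Finset.sum_const, ← Nat.cast_smul_eq_nsmul ℝ, lapElt, sub_mul,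
      one_mul, smul_mul_assoc, sub_mul, smul_mul_assoc, one_mul, Finset.sum_mul, smul_sub,
      smul_add]
    nth_rewrite 1 [← h1]
    abel
  rw [h, map_smul, norm_smul, map_sum, norm_inv, Real.norm_of_nonneg (by positivity),
    inv_mul_le_iff₀ (by positivity)]
  refine (norm_sum_le_of_le _ (f := fun s => toL2 (g + single s 1 * g))
    (n := fun _ => 2 * ‖toL2 g‖) fun s _ => ?_).trans ?_
  · rw [map_add]
    refine (norm_add_le _ _).trans ?_
    rw [norm_toL2_single_mul, two_mul]
  · rw [Finset.sum_const, nsmul_eq_mul]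
    linarith

lemma norm_toL2_lazy_pow_mul_le (hSne : S.Nonempty) (n : ℕ) (g : MonoidAlgebra ℝ Γ) :
    ‖toL2 ((1 - (2 * S.card : ℝ)⁻¹ • lapElt S) ^ n * g)‖ ≤ ‖toL2 g‖ := by
  induction n with
  | zero => simp
  | succ n ih =>
    rw [pow_succ', mul_assoc]
    exact (norm_toL2_lazy_mul_le hSne _).trans ih

/-- A Nash-type inequality for powers of the lazy random walk. -/
lemma coeff_lazy_pow_le (hS1 : (1 : Γ) ∉ S) (hSsym : ∀ s ∈ S, s⁻¹ ∈ S) (hSne : S.Nonempty)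
    (hgen : Subgroup.closure (S : Set Γ) = ⊤) {r : ℕ}
    (hfin : {x : Γ | (cayleyGraph S).dist 1 x ≤ r}.Finite) (n : ℕ) (q : ℝ[X])
    (hq : q = (1 - Polynomial.C (2 * S.card : ℝ)⁻¹ * Polynomial.X) ^ n) :
    (aeval (lapElt S) (q ^ 2)).coeff 1 ≤
      4 * r ^ 2 * (aeval (lapElt S) (Polynomial.X * q ^ 2)).coeff 1 +
        2 * (Nat.card {x : Γ | (cayleyGraph S).dist 1 x ≤ r} : ℝ)⁻¹ := by
  set f := aeval (lapElt S) q with hf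
  have hfp : f = (1 - (2 * S.card : ℝ)⁻¹ • lapElt S) ^ n := by
    rw [hf, hq]
    simp [Algebra.smul_def]
  have hB : hfin.toFinset.Nonempty := ⟨1, by simp⟩
  set α : MonoidAlgebra ℝ Γ := (hfin.toFinset.card : ℝ)⁻¹ • ∑ y ∈ hfin.toFinset, single y 1
  set D := inner ℝ (toL2 (f * lapElt S)) (toL2 f) with hD
  have hDeq : D = (aeval (lapElt S) (Polynomial.X * q ^ 2)).coeff 1 := by
    rw [hD, inner_toL2, ← coeff_mul_one_of_symm _ _ (coeff_aeval_lapElt_inv hSsym q), map_mul,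
      Polynomial.aeval_X, map_pow, ← hf, sq, ← mul_assoc]
    have : Commute f (lapElt S) := by
      rw [hf]
      nth_rewrite 2 [← Polynomial.aeval_X (R := ℝ) (lapElt S)]
      exact (Commute.all q Polynomial.X).map (aeval (lapElt S))
    rw [this.eq]
  have hD0 : 0 ≤ 2 * D := by
    rw [hD, ← sum_norm_toL2_sub_sq S]
    positivity
  have h1 : ‖toL2 (f - f * α)‖ ≤ r * √(2 * D) := by
    refine norm_toL2_sub_mul_average_le f hB fun y hy => ?_
    obtain ⟨p, hp⟩ :=
      ((cayleyGraph_connected hS1 hSsym hgen).preconnected 1 y).exists_walk_length_eq_dist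
    have h := norm_toL2_sub_mul_single_le hSsym f p
    rw [inv_one, one_mul, hp] at h
    refine h.trans ?_
    have : (cayleyGraph S).dist 1 y ≤ r := by simpa using hy
    gcongr
  have h2 : ‖toL2 (f * α)‖ ^ 2 ≤ (hfin.toFinset.card : ℝ)⁻¹ := by
    rw [← norm_toL2_average_sq hB, hfp]
    gcongr
    exact norm_toL2_lazy_pow_mul_le hSne n α
  have h3 : ‖toL2 f‖ ≤ ‖toL2 (f - f * α)‖ + ‖toL2 (f * α)‖ := by
    refine le_of_eq_of_le ?_ (norm_add_le _ _)
    rw [← map_add, sub_add_cancel]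
  have h4 : ‖toL2 (f - f * α)‖ ^ 2 ≤ r ^ 2 * (2 * D) := by
    rw [← Real.sq_sqrt hD0, ← mul_pow]
    gcongr
  rw [← norm_toL2_aeval_sq hSsym, ← hf, ← hDeq, Nat.card_coe_set_eq,
    Set.ncard_eq_toFinset_card _ hfin]
  have h5 : ‖toL2 f‖ ^ 2 ≤ (‖toL2 (f - f * α)‖ + ‖toL2 (f * α)‖) ^ 2 := by gcongr
  nlinarith [sq_nonneg (‖toL2 (f - f * α)‖ - ‖toL2 (f * α)‖)]

end SpectralBounds

section MomentBounds

open Polynomial (Chebyshev.T)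
open scoped Polynomial

lemma integrable_of_continuous_of_compl_Icc_null {μ : Measure ℝ} [IsFiniteMeasure μ] {K : ℝ}
    (hsupp : μ (Set.Icc 0 K)ᶜ = 0) {g : ℝ → ℝ} (hg : Continuous g) : Integrable g μ := by
  rw [← Measure.restrict_eq_self_of_ae_mem (s := Set.Icc 0 K) (μ := μ) (mem_ae_iff.2 hsupp)]
  exact hg.continuousOn.integrableOn_compact isCompact_Icc

lemma integral_le_measureReal_Iic_add {μ : Measure ℝ} [IsProbabilityMeasure μ] {K : ℝ}
    (hsupp : μ (Set.Icc 0 K)ᶜ = 0) {g : ℝ → ℝ} (hg : Continuous g) {E m : ℝ} (hm : 0 ≤ m)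
    (h1 : ∀ t ∈ Set.Icc 0 K, t ≤ E → g t ≤ 1) (h2 : ∀ t ∈ Set.Icc 0 K, E < t → g t ≤ m) :
    ∫ t, g t ∂μ ≤ μ.real (Set.Iic E) + m := by
  have hint : Integrable (fun t => (Set.Iic E).indicator (fun _ => (1 : ℝ)) t + m) μ :=
    ((integrable_const 1).indicator measurableSet_Iic).add (integrable_const m)
  have hle : g ≤ᵐ[μ] fun t => (Set.Iic E).indicator (fun _ => (1 : ℝ)) t + m := by
    filter_upwards [mem_ae_iff.2 hsupp] with t ht
    by_cases htE : t ≤ E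
    · rw [Set.indicator_of_mem (by exact htE)]
      linarith [h1 t ht htE]
    · rw [Set.indicator_of_notMem (by exact htE)]
      linarith [h2 t ht (not_le.1 htE)]
  refine (integral_mono_ae (integrable_of_continuous_of_compl_Icc_null hsupp hg) hint hle).trans ?_
  rw [integral_add ((integrable_const 1).indicator measurableSet_Iic) (integrable_const m),
    integral_indicator_const _ measurableSet_Iic]
  simp

lemma abs_eval_T_le_cosh {θ : ℝ} (n : ℕ) {x : ℝ} (h1 : -1 ≤ x)
    (h2 : x ≤ Real.cosh θ) : |(Chebyshev.T ℝ n).eval x| ≤ Real.cosh (n * θ) := by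
  rcases le_total x 1 with hx | hx
  · exact (Polynomial.Chebyshev.abs_eval_T_real_le_one n (abs_le.2 ⟨h1, hx⟩)).trans
      (Real.one_le_cosh _)
  · have hs := Real.cosh_arcosh hx
    have h3 : |Real.arcosh x| ≤ |θ| := by rwa [← Real.cosh_le_cosh, hs]
    rw [← hs, Polynomial.Chebyshev.T_real_cosh, abs_of_pos (Real.cosh_pos _), Real.cosh_le_cosh]
    simp only [Int.cast_natCast, abs_mul, Nat.abs_cast]
    gcongr

/-- A polynomial of degree at most `n`, normalised at `0`, bounded by `1` on `[0, 2k]` and by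
`1 / cosh (n √(E / k))` on `[E, 2k]`. -/
lemma exists_chebyshev_filter {k E : ℝ} (hk : 0 < k) (hE : 0 ≤ E) (hEk : E ≤ k) (n : ℕ) :
    ∃ q : ℝ[X], q.natDegree ≤ n ∧ q.eval 0 = 1 ∧
      (∀ t ∈ Set.Icc 0 (2 * k), q.eval t ^ 2 ≤ 1) ∧
      ∀ t ∈ Set.Icc 0 (2 * k), E ≤ t →
        q.eval t ^ 2 ≤ (Real.cosh (n * √(E / k)) ^ 2)⁻¹ := by
  set θ := √(E / k) with hθ
  have hθ0 : 0 ≤ θ := Real.sqrt_nonneg _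
  have hθsq : θ ^ 2 = E / k := Real.sq_sqrt (by positivity)
  have hEk1 : E / k ≤ 1 := (div_le_one hk).2 hEk
  have hcosh : Real.cosh θ ≤ 1 + E / k := by
    refine (Real.cosh_le_exp_half_sq θ).trans ?_
    rw [hθsq]
    have h0 : 0 ≤ E / k := by positivity
    refine (Real.exp_bound_div_one_sub_of_interval (by positivity) (by linarith)).trans ?_
    rw [div_le_iff₀ (by linarith)]
    nlinarith
  have hcosh1 := Real.one_le_cosh θ
  set β := (1 + Real.cosh θ) / (2 * k) with hβ
  have hβ0 : 0 ≤ β := by positivity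
  have hβk : β * (2 * k) = 1 + Real.cosh θ := by rw [hβ]; field_simp
  have hβE : Real.cosh θ - 1 ≤ β * E := by
    have : 1 / k ≤ β := by
      rw [hβ, div_le_div_iff₀ hk (by positivity)]
      nlinarith
    calc Real.cosh θ - 1 ≤ 1 / k * E := by rw [one_div_mul_eq_div]; linarith
      _ ≤ β * E := by gcongr
  have hc : 0 < Real.cosh (n * θ) := Real.cosh_pos _
  let q : ℝ[X] := Polynomial.C (Real.cosh (n * θ))⁻¹ *
    (Chebyshev.T ℝ n).comp (Polynomial.C (Real.cosh θ) - Polynomial.C β * Polynomial.X)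
  have heval : ∀ t, q.eval t ^ 2 =
      |(Chebyshev.T ℝ n).eval (Real.cosh θ - β * t)| ^ 2 * (Real.cosh (n * θ) ^ 2)⁻¹ := by
    intro t
    simp only [q, Polynomial.eval_mul, Polynomial.eval_C, Polynomial.eval_comp,
      Polynomial.eval_sub, Polynomial.eval_X]
    rw [mul_pow, sq_abs, inv_pow, mul_comm]
  have hlow : ∀ t ∈ Set.Icc 0 (2 * k), -1 ≤ Real.cosh θ - β * t := by
    intro t ht
    have := mul_le_mul_of_nonneg_left ht.2 hβ0
    linarith
  refine ⟨q, ?_, ?_, fun t ht => ?_, fun t ht htE => ?_⟩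
  · refine (Polynomial.natDegree_C_mul_le _ _).trans ?_
    rw [Polynomial.natDegree_comp, Polynomial.Chebyshev.natDegree_T, Int.natAbs_natCast]
    refine (Nat.mul_le_mul_left n ?_).trans (mul_one n).le
    compute_degree
  · simp [q, Polynomial.Chebyshev.T_real_cosh, hc.ne']
  · rw [heval, ← div_eq_mul_inv, div_le_one (by positivity)]
    gcongr
    exact abs_eval_T_le_cosh n (hlow t ht) (by nlinarith [ht.1])
  · rw [heval]
    refine mul_le_of_le_one_left (by positivity) (pow_le_one₀ (abs_nonneg _) ?_)
    refine Polynomial.Chebyshev.abs_eval_T_real_le_one n (abs_le.2 ⟨hlow t ht, ?_⟩)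
    have := mul_le_mul_of_nonneg_left htE hβ0
    linarith

lemma integral_X_mul_lazy_pow_le {μ : Measure ℝ} [IsProbabilityMeasure μ] {K : ℝ} (hK : 0 < K)
    (hsupp : μ (Set.Icc 0 K)ᶜ = 0) (n : ℕ) {E : ℝ} (hE0 : 0 ≤ E) :
    ∫ t, t * ((1 - K⁻¹ * t) ^ n) ^ 2 ∂μ ≤
      E * ∫ t, ((1 - K⁻¹ * t) ^ n) ^ 2 ∂μ + K * Real.exp (-(2 * n * E / K)) := by
  have hint : Integrable (fun t => E * ((1 - K⁻¹ * t) ^ n) ^ 2) μ :=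
    integrable_of_continuous_of_compl_Icc_null hsupp (by fun_prop)
  rw [← integral_const_mul]
  calc _ ≤ ∫ t, (E * ((1 - K⁻¹ * t) ^ n) ^ 2 + K * Real.exp (-(2 * n * E / K))) ∂μ := by
        refine integral_mono_ae
          (integrable_of_continuous_of_compl_Icc_null hsupp (by fun_prop))
          (hint.add (integrable_const _)) ?_
        filter_upwards [mem_ae_iff.2 hsupp] with t ht
        have hx : 0 ≤ 1 - K⁻¹ * t := by
          rw [sub_nonneg, inv_mul_le_iff₀ hK]
          linarith [ht.2]
        rcases le_total t E with htE | htE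
        · have : t * ((1 - K⁻¹ * t) ^ n) ^ 2 ≤ E * ((1 - K⁻¹ * t) ^ n) ^ 2 := by gcongr
          have : 0 ≤ K * Real.exp (-(2 * n * E / K)) := by positivity
          linarith
        · have h1 : ((1 - K⁻¹ * t) ^ n) ^ 2 ≤ Real.exp (-(2 * n * E / K)) := by
            calc ((1 - K⁻¹ * t) ^ n) ^ 2 ≤ (Real.exp (-(K⁻¹ * E)) ^ n) ^ 2 := by
                  gcongr
                  refine le_trans ?_ (Real.one_sub_le_exp_neg _)
                  gcongr
              _ = Real.exp (-(2 * n * E / K)) := by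
                  rw [← pow_mul, ← Real.exp_nat_mul]
                  congr 1
                  push_cast
                  ring
          have h2 : t * ((1 - K⁻¹ * t) ^ n) ^ 2 ≤ K * Real.exp (-(2 * n * E / K)) :=
            mul_le_mul ht.2 h1 (by positivity) hK.le
          have : 0 ≤ E * ((1 - K⁻¹ * t) ^ n) ^ 2 := by positivity
          linarith
    _ = _ := by
        rw [integral_add hint (integrable_const _)]
        simp

lemma measureReal_Iic_le_integral_lazy_pow {μ : Measure ℝ} [IsProbabilityMeasure μ] {K : ℝ}
    (hK : 0 < K) (hsupp : μ (Set.Icc 0 K)ᶜ = 0) (n : ℕ) {E : ℝ} (hEK : E ≤ K)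
    (hn : 4 * n * E ≤ K) :
    μ.real (Set.Iic E) ≤ 2 * ∫ t, ((1 - K⁻¹ * t) ^ n) ^ 2 ∂μ := by
  rw [← integral_const_mul, ← integral_indicator_one measurableSet_Iic]
  refine integral_mono_ae ((integrable_const 1).indicator measurableSet_Iic)
    (integrable_of_continuous_of_compl_Icc_null hsupp (by fun_prop)) ?_
  filter_upwards [mem_ae_iff.2 hsupp] with t ht
  by_cases htE : t ≤ E
  · rw [Set.indicator_of_mem (by exact htE), Pi.one_apply, ← pow_mul]
    have hx : K⁻¹ * t ≤ 1 := by
      rw [inv_mul_le_iff₀ hK]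
      linarith
    have hb := one_add_mul_le_pow (a := -(K⁻¹ * t)) (by linarith) (n * 2)
    have hy : (n : ℝ) * 2 * (K⁻¹ * t) ≤ 1 / 2 := by
      calc (n : ℝ) * 2 * (K⁻¹ * t) ≤ n * 2 * (K⁻¹ * E) := by gcongr
        _ = K⁻¹ * (4 * n * E) / 2 := by ring
        _ ≤ K⁻¹ * K / 2 := by gcongr
        _ = 1 / 2 := by rw [inv_mul_cancel₀ hK.ne']
    push_cast at hb
    rw [← sub_eq_add_neg] at hb
    linarith
  · rw [Set.indicator_of_notMem (by exact htE)]
    positivity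

end MomentBounds

section Asymptotics

lemma tendsto_rpow_mul_exp_neg_rpow_nhdsGT_zero (m : ℝ) {ε c : ℝ} (hε : 0 < ε) (hc : 0 < c) :
    Tendsto (fun E : ℝ => E ^ (-m) * Real.exp (-(c * E ^ (-ε)))) (𝓝[>] 0) (𝓝 0) := by
  have h := (tendsto_rpow_mul_exp_neg_mul_atTop_nhds_zero (m / ε) c hc).comp
    (tendsto_rpow_neg_nhdsGT_zero (neg_lt_zero.2 hε))
  refine h.congr' ?_
  filter_upwards [self_mem_nhdsWithin] with E hE
  have hE' : (0 : ℝ) < E := hE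
  simp only [Function.comp_apply, neg_mul]
  rw [← Real.rpow_mul hE'.le]
  congr 2
  field_simp

lemma tendsto_log_div_log_of_rpow_bounds {N : ℝ → ℝ} {D : ℝ}
    (hlow : ∀ p, D < p → ∃ c > 0, ∀ᶠ E in 𝓝[>] (0 : ℝ), c * E ^ p ≤ N E)
    (hupp : ∀ p, p < D → ∃ C > 0, ∀ᶠ E in 𝓝[>] (0 : ℝ), N E ≤ C * E ^ p) :
    Tendsto (fun E => Real.log (N E) / Real.log E) (𝓝[>] 0) (𝓝 D) := by
  have hlog : ∀ c p : ℝ, Tendsto (fun E => Real.log c / Real.log E + p) (𝓝[>] 0) (𝓝 p) := by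
    intro c p
    simpa using (Real.tendsto_log_nhdsGT_zero.const_div_atBot (Real.log c)).add_const p
  have hsmall : ∀ᶠ E : ℝ in 𝓝[>] 0, 0 < E ∧ E < 1 :=
    Ioo_mem_nhdsGT one_pos
  have hsplit : ∀ {c p E : ℝ}, 0 < c → 0 < E → E < 1 →
      Real.log (c * E ^ p) / Real.log E = Real.log c / Real.log E + p := by
    intro c p E hc hE hE1
    have hne : Real.log E ≠ 0 := (Real.log_neg hE hE1).ne
    rw [Real.log_mul hc.ne' (Real.rpow_pos_of_pos hE p).ne', Real.log_rpow hE]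
    field_simp
  obtain ⟨c₀, hc₀, hN₀⟩ := hlow (D + 1) (by linarith)
  rw [tendsto_order]
  constructor
  · intro x hx
    obtain ⟨p, hxp, hpD⟩ := exists_between hx
    obtain ⟨C, hC, hN⟩ := hupp p hpD
    filter_upwards [hN, hN₀, hsmall, (hlog C p).eventually_const_lt hxp] with E hE hE₀ hs hx
    rw [← hsplit hC hs.1 hs.2] at hx
    have hpos : 0 < N E := lt_of_lt_of_le (mul_pos hc₀ (Real.rpow_pos_of_pos hs.1 _)) hE₀
    exact hx.trans_le
      (div_le_div_of_nonpos_of_le (Real.log_neg hs.1 hs.2).le (Real.log_le_log hpos hE))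
  · intro x hx
    obtain ⟨p, hDp, hpx⟩ := exists_between hx
    obtain ⟨c, hc, hN⟩ := hlow p hDp
    filter_upwards [hN, hsmall, (hlog c p).eventually_lt_const hpx] with E hE hs hx
    rw [← hsplit hc hs.1 hs.2] at hx
    exact (div_le_div_of_nonpos_of_le (Real.log_neg hs.1 hs.2).le
      (Real.log_le_log (mul_pos hc (Real.rpow_pos_of_pos hs.1 _)) hE)).trans_lt hx

lemma exists_rpow_le_of_volume_upper {N : ℝ → ℝ} {k b : ℝ} (hk : 0 < k) (hb : 0 < b) (d : ℕ)
    (h : ∀ E, 0 < E → E ≤ k → ∀ n : ℕ, 1 ≤ n →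
      1 ≤ b * n ^ d * (N E + (Real.cosh (n * √(E / k)) ^ 2)⁻¹)) {p : ℝ} (hp : (d : ℝ) / 2 < p) :
    ∃ c > 0, ∀ᶠ E in 𝓝[>] (0 : ℝ), c * E ^ p ≤ N E := by
  have hD : (0 : ℝ) ≤ d / 2 := by positivity
  set ε := (p - d / 2) / (d / 2 + 1) with hεdef
  have hε : 0 < ε := div_pos (by linarith) (by linarith)
  have hεp : (1 + ε) / 2 * d ≤ p := by
    have h1 : ε * (d / 2 + 1) = p - d / 2 := by rw [hεdef]; field_simp
    nlinarith
  set γ := (1 + ε) / 2 with hγ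
  have hdecay := tendsto_rpow_mul_exp_neg_rpow_nhdsGT_zero (γ * d) (half_pos hε)
    (show 0 < 2 / √k by positivity)
  have hM : 0 < b * 2 ^ d := by positivity
  refine ⟨(2 * (b * 2 ^ d))⁻¹, by positivity, ?_⟩
  filter_upwards [Ioo_mem_nhdsGT one_pos, Ioo_mem_nhdsGT hk,
    hdecay.eventually_lt_const (show (0 : ℝ) < (8 * (b * 2 ^ d))⁻¹ by positivity)]
    with E hE1 hEk hdec
  have hE : 0 < E := hE1.1
  have hx1 : 1 ≤ E ^ (-γ) :=
    Real.one_le_rpow_of_pos_of_le_one_of_nonpos hE hE1.2.le (by rw [hγ]; linarith)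
  set n := ⌈E ^ (-γ)⌉₊ with hn
  have hn1 : E ^ (-γ) ≤ n := Nat.le_ceil _
  have hn2 : (n : ℝ) ≤ 2 * E ^ (-γ) := by
    have := Nat.ceil_lt_add_one (zero_le_one.trans hx1)
    linarith
  have hnd : (n : ℝ) ^ d ≤ 2 ^ d * E ^ (-(γ * d)) := by
    calc (n : ℝ) ^ d ≤ (2 * E ^ (-γ)) ^ d := by gcongr
      _ = 2 ^ d * E ^ (-(γ * d)) := by
        rw [mul_pow, ← Real.rpow_mul_natCast hE.le, neg_mul]
  have hcosh : (Real.cosh (n * √(E / k)) ^ 2)⁻¹ ≤ 4 * Real.exp (-(2 / √k * E ^ (-(ε / 2)))) := by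
    have h1 : E ^ (-(ε / 2)) / √k ≤ n * √(E / k) := by
      rw [Real.sqrt_div hE.le, ← mul_div_assoc]
      gcongr
      calc E ^ (-(ε / 2)) = E ^ (-γ) * √E := by
            rw [Real.sqrt_eq_rpow, ← Real.rpow_add hE, hγ]
            ring_nf
        _ ≤ n * √E := by gcongr
    have h2 : Real.exp (E ^ (-(ε / 2)) / √k) / 2 ≤ Real.cosh (n * √(E / k)) := by
      rw [Real.cosh_eq]
      have := Real.exp_le_exp.2 h1
      have := Real.exp_pos (-(n * √(E / k)))
      linarith
    calc (Real.cosh (n * √(E / k)) ^ 2)⁻¹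
        ≤ ((Real.exp (E ^ (-(ε / 2)) / √k) / 2) ^ 2)⁻¹ := by gcongr
      _ = 4 * Real.exp (-(2 / √k * E ^ (-(ε / 2)))) := by
        rw [Real.exp_neg, div_pow, ← Real.exp_nat_mul, inv_div, div_eq_mul_inv]
        congr 2
        · norm_num
        · push_cast
          ring_nf
  have hmain := h E hE hEk.2.le n (by exact_mod_cast hx1.trans hn1)
  set F := E ^ (-(γ * d)) with hF
  have hFpos : 0 < F := Real.rpow_pos_of_pos hE _
  set e := Real.exp (-(2 / √k * E ^ (-(ε / 2))))
  have hNE : 0 < N E + (Real.cosh (n * √(E / k)) ^ 2)⁻¹ := by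
    by_contra! hneg
    have : b * (n : ℝ) ^ d * (N E + (Real.cosh (n * √(E / k)) ^ 2)⁻¹) ≤ 0 :=
      mul_nonpos_of_nonneg_of_nonpos (by positivity) hneg
    linarith
  have h3 : 1 ≤ b * 2 ^ d * F * (N E + 4 * e) := by
    calc 1 ≤ b * (n : ℝ) ^ d * (N E + (Real.cosh (n * √(E / k)) ^ 2)⁻¹) := hmain
      _ ≤ b * (2 ^ d * F) * (N E + 4 * e) := by gcongr
      _ = _ := by ring
  have h4 : b * 2 ^ d * (4 * (F * e)) ≤ 1 / 2 := by
    calc b * 2 ^ d * (4 * (F * e)) ≤ b * 2 ^ d * (4 * (8 * (b * 2 ^ d))⁻¹) := by gcongr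
      _ = 1 / 2 := by field_simp; norm_num
  have h5 : 1 / 2 ≤ b * 2 ^ d * F * N E := by linarith
  have hEp : E ^ p * F ≤ 1 := by
    rw [hF, ← Real.rpow_add hE]
    exact Real.rpow_le_one hE.le hE1.2.le (by linarith)
  have hN0 : 0 < N E := pos_of_mul_pos_right (by linarith) (by positivity : 0 ≤ b * 2 ^ d * F)
  rw [inv_mul_le_iff₀ (by positivity)]
  calc E ^ p = E ^ p * 1 := (mul_one _).symm
    _ ≤ E ^ p * (2 * (b * 2 ^ d * F * N E)) := by gcongr; linarith
    _ = E ^ p * F * (2 * (b * 2 ^ d) * N E) := by ring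
    _ ≤ 2 * (b * 2 ^ d) * N E := mul_le_of_le_one_left (by positivity) hEp

lemma exists_le_rpow_of_volume_lower {N : ℝ → ℝ} {u : ℕ → ℝ} {K a : ℝ} (hK : 2 ≤ K) (ha : 0 < a)
    (d : ℕ)
    (hN : ∀ E, 0 < E → E ≤ K → ∀ n : ℕ, 4 * n * E ≤ K → N E ≤ 2 * u n)
    (hu0 : ∀ n, 0 ≤ u n)
    (hu : ∀ n r : ℕ, 1 ≤ r → ∀ E, 0 ≤ E →
      u n ≤ 4 * r ^ 2 * (E * u n + K * Real.exp (-(2 * n * E / K))) + 2 * (a * r ^ d)⁻¹)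
    {p : ℝ} (hp : p < (d : ℝ) / 2) :
    ∃ C > 0, ∀ᶠ E in 𝓝[>] (0 : ℝ), N E ≤ C * E ^ p := by
  have hD : (0 : ℝ) ≤ d / 2 := by positivity
  have hK0 : 0 < K := by linarith
  set ε := (d / 2 - p) / (d / 2 + (d / 2 - p) + 1) with hεdef
  have hden : 0 < (d : ℝ) / 2 + (d / 2 - p) + 1 := by linarith
  have hε : 0 < ε := div_pos (by linarith) hden
  have hε1 : ε < 1 := (div_lt_one hden).2 (by linarith)
  have hεp : p ≤ (1 - ε) * (d / 2) := by
    have h1 : ε * (d / 2 + (d / 2 - p) + 1) = d / 2 - p := by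
      rw [hεdef, div_mul_cancel₀ _ hden.ne']
    nlinarith
  set δ := 1 - ε with hδ
  have hδ0 : 0 < δ := by linarith
  have hdecay := tendsto_rpow_mul_exp_neg_rpow_nhdsGT_zero (δ + δ * (d / 2)) hε
    (show 0 < 1 / (2 * K) by positivity)
  have hsmall : Tendsto (fun E : ℝ => E ^ δ) (𝓝[>] 0) (𝓝 0) := by
    have := (Real.continuousAt_rpow_const 0 δ (Or.inr hδ0.le)).tendsto
    rw [Real.zero_rpow hδ0.ne'] at this
    exact this.mono_left nhdsWithin_le_nhds
  refine ⟨2 * (2 * K + 4 * (a⁻¹ * √32 ^ d)), by positivity, ?_⟩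
  filter_upwards [Ioo_mem_nhdsGT (show (0 : ℝ) < 1 / 2 by norm_num),
    hdecay.eventually_lt_const one_pos,
    hsmall.eventually_lt_const (show (0 : ℝ) < 1 / 8 by norm_num)] with E hE1 hdec hE8
  have hE : 0 < E := hE1.1
  have hE1' : E ≤ 1 := by linarith [hE1.2]
  set n := ⌊1 / (2 * E)⌋₊ with hn
  have hx1 : 1 ≤ 1 / (2 * E) := by
    rw [le_div_iff₀ (by positivity)]
    linarith [hE1.2]
  have hnle : (n : ℝ) ≤ 1 / (2 * E) := Nat.floor_le (by positivity)
  have hnge : 1 / (4 * E) ≤ n := by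
    have h1 := Nat.lt_floor_add_one (1 / (2 * E))
    have h2 : (1 : ℝ) ≤ n := by exact_mod_cast Nat.le_floor (by simpa using hx1)
    have h3 : 1 / (4 * E) = 1 / (2 * E) / 2 := by field_simp; norm_num
    rw [h3]
    linarith
  set E' := E ^ δ with hE'
  have hE'0 : 0 < E' := Real.rpow_pos_of_pos hE _
  set y := (√(8 * E'))⁻¹ with hy
  have hy0 : 0 < y := by positivity
  have hysq : y ^ 2 * (8 * E') = 1 := by
    rw [hy, inv_pow, Real.sq_sqrt (by positivity)]
    field_simp
  have hy1 : 1 ≤ y := by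
    rw [hy, one_le_inv₀ (by positivity), Real.sqrt_le_iff]
    constructor <;> linarith
  set r := ⌊y⌋₊ with hr
  have hr1 : 1 ≤ r := Nat.le_floor (by simpa using hy1)
  have hrle : (r : ℝ) ≤ y := Nat.floor_le hy0.le
  have hrge : y / 2 ≤ r := by
    have h1 := Nat.lt_floor_add_one y
    have h2 : (1 : ℝ) ≤ r := by exact_mod_cast hr1
    linarith
  have hrsq : 4 * (r : ℝ) ^ 2 * E' ≤ 1 / 2 := by
    calc 4 * (r : ℝ) ^ 2 * E' ≤ 4 * y ^ 2 * E' := by gcongr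
      _ = y ^ 2 * (8 * E') / 2 := by ring
      _ = 1 / 2 := by rw [hysq]
  have hexp : Real.exp (-(2 * n * E' / K)) ≤ Real.exp (-(1 / (2 * K) * E ^ (-ε))) := by
    gcongr
    have h1 : E ^ (-ε) = E' / E := by
      rw [hE', ← Real.rpow_sub_one hE.ne', hδ]
      ring_nf
    calc 1 / (2 * K) * E ^ (-ε) = 2 * (1 / (4 * E)) * E' / K := by
          rw [h1]; field_simp; norm_num
      _ ≤ 2 * n * E' / K := by gcongr
  have hrem : 4 * (r : ℝ) ^ 2 * (K * Real.exp (-(2 * n * E' / K))) ≤ K * E ^ (δ * (d / 2)) := by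
    set e := Real.exp (-(1 / (2 * K) * E ^ (-ε)))
    have h1 : E'⁻¹ * e ≤ E ^ (δ * (d / 2)) := by
      rw [neg_add, Real.rpow_add hE, Real.rpow_neg hE.le, Real.rpow_neg hE.le, mul_right_comm,
        ← div_eq_mul_inv, div_lt_one (by positivity)] at hdec
      exact hdec.le
    have h2 : 4 * (r : ℝ) ^ 2 ≤ E'⁻¹ := by
      rw [← one_div, le_div_iff₀ hE'0]
      linarith
    calc 4 * (r : ℝ) ^ 2 * (K * Real.exp (-(2 * n * E' / K))) ≤ E'⁻¹ * (K * e) := by gcongr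
      _ = K * (E'⁻¹ * e) := by ring
      _ ≤ K * E ^ (δ * (d / 2)) := by gcongr
  have hvol : (a * (r : ℝ) ^ d)⁻¹ ≤ a⁻¹ * √32 ^ d * E ^ (δ * (d / 2)) := by
    have h1 : (r : ℝ)⁻¹ ≤ √32 * E ^ (δ / 2) := by
      calc (r : ℝ)⁻¹ ≤ (y / 2)⁻¹ := by gcongr
        _ = 2 * √(8 * E') := by rw [hy, inv_div, div_inv_eq_mul]
        _ = √32 * E ^ (δ / 2) := by
          rw [Real.sqrt_mul (by norm_num), hE', Real.sqrt_eq_rpow (E ^ δ), ← Real.rpow_mul hE.le,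
            show (32 : ℝ) = 2 ^ 2 * 8 by norm_num, Real.sqrt_mul (by norm_num),
            Real.sqrt_sq (by norm_num)]
          ring_nf
    rw [mul_inv, ← inv_pow, mul_assoc]
    gcongr
    calc ((r : ℝ)⁻¹) ^ d ≤ (√32 * E ^ (δ / 2)) ^ d := by gcongr
      _ = √32 ^ d * E ^ (δ * (d / 2)) := by
        rw [mul_pow, ← Real.rpow_mul_natCast hE.le]
        ring_nf
  have hmain := hu n r hr1 E' hE'0.le
  have hru : 4 * (r : ℝ) ^ 2 * E' * u n ≤ 1 / 2 * u n :=
    mul_le_mul_of_nonneg_right hrsq (hu0 n)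
  have hun : u n ≤ (2 * K + 4 * (a⁻¹ * √32 ^ d)) * E ^ (δ * (d / 2)) := by
    linarith
  have hNn : N E ≤ 2 * u n := by
    refine hN E hE (by linarith) n ?_
    calc 4 * n * E ≤ 4 * (1 / (2 * E)) * E := by gcongr
      _ = 2 := by field_simp; norm_num
      _ ≤ K := hK
  calc N E ≤ 2 * ((2 * K + 4 * (a⁻¹ * √32 ^ d)) * E ^ (δ * (d / 2))) := by linarith
    _ ≤ 2 * ((2 * K + 4 * (a⁻¹ * √32 ^ d)) * E ^ p) := by
      have := Real.rpow_le_rpow_of_exponent_ge hE hE1' hεp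
      gcongr
    _ = _ := by ring

end Asymptotics

lemma integral_eval_eq_coeff_aeval_lapElt {Γ : Type*} [Group Γ] {S : Finset Γ}
    (hSsym : ∀ s ∈ S, s⁻¹ ∈ S) {μ : Measure ℝ} [IsProbabilityMeasure μ]
    (hsupp : μ (Set.Icc (0 : ℝ) (2 * S.card))ᶜ = 0)
    (hmom : ∀ j : ℕ,
      ∫ t, t ^ j ∂μ = (lapOp S)^[j] (fun x => if x = (1 : Γ) then 1 else 0) 1)
    (q : Polynomial ℝ) :
    ∫ t, q.eval t ∂μ = (Polynomial.aeval (lapElt S) q).coeff 1 := by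
  simp only [Polynomial.eval_eq_sum_range, Polynomial.aeval_eq_sum_range]
  rw [integral_finsetSum _ fun i _ =>
    integrable_of_continuous_of_compl_Icc_null hsupp (by fun_prop)]
  simp only [integral_const_mul, hmom, lapOp_iterate_eq_coeff hSsym, MonoidAlgebra.coeff_sum,
    Finsupp.finsetSum_apply, MonoidAlgebra.coeff_smul, Finsupp.smul_apply, smul_eq_mul]

/-- Let `Γ` be an infinite finitely generated (amenable) group of polynomial
growth of order `d` and `H` the combinatorial Laplacian on a Cayley graph of `Γ`.  Let `μ` be
the spectral measure of `H` at `δ_ι`, i.e. the compactly supported probability measure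
characterised by its moments `∫ t^j dμ(t) = ⟨δ_ι, H^j δ_ι⟩`, so that the integrated density of
states is `N_per(E) = ⟨δ_ι, χ_{(−∞,E]}(H) δ_ι⟩ = μ((−∞,E])`.  Then
`lim_{E↘0} ln N_per(E) / ln E = d/2`. -/
theorem van_hove_exponent_polynomial_growth
    {Γ : Type*} [Group Γ] [Infinite Γ] (S : Finset Γ)
    (hS1 : (1 : Γ) ∉ S) (hSsym : ∀ s ∈ S, s⁻¹ ∈ S) (hSne : S.Nonempty)
    (hgen : Subgroup.closure (S : Set Γ) = ⊤)
    (d : ℕ) (a b : ℝ) (ha : 0 < a) (hb : 0 < b)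
    (hgrowth : ∀ n : ℕ, 1 ≤ n →
      a * (n : ℝ) ^ d ≤ (Nat.card {x : Γ | (cayleyGraph S).dist 1 x ≤ n} : ℝ) ∧
      (Nat.card {x : Γ | (cayleyGraph S).dist 1 x ≤ n} : ℝ) ≤ b * (n : ℝ) ^ d)
    (μ : Measure ℝ) [IsProbabilityMeasure μ]
    (hsupp : μ (Set.Icc (0 : ℝ) (2 * S.card))ᶜ = 0)
    (hmom : ∀ j : ℕ,
      ∫ t, t ^ j ∂μ = (lapOp S)^[j] (fun x => if x = (1 : Γ) then 1 else 0) 1) :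
    Tendsto (fun E : ℝ => Real.log (μ (Set.Iic E)).toReal / Real.log E)
      (𝓝[>] 0) (𝓝 ((d : ℝ) / 2)) := by
  have hk : (0 : ℝ) < S.card := by exact_mod_cast hSne.card_pos
  have hk1 : (1 : ℝ) ≤ S.card := by exact_mod_cast hSne.card_pos
  have hfin : ∀ n : ℕ, 1 ≤ n → {x : Γ | (cayleyGraph S).dist 1 x ≤ n}.Finite := by
    intro n hn
    have hpos : (0 : ℝ) < Nat.card {x : Γ | (cayleyGraph S).dist 1 x ≤ n} := by
      refine lt_of_lt_of_le ?_ (hgrowth n hn).1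
      have : (0 : ℝ) < n := by exact_mod_cast hn
      positivity
    exact Set.finite_coe_iff.1 (Nat.finite_of_card_ne_zero (by exact_mod_cast hpos.ne'))
  have hint := integral_eval_eq_coeff_aeval_lapElt hSsym hsupp hmom
  refine tendsto_log_div_log_of_rpow_bounds (N := fun E => μ.real (Set.Iic E)) (fun p hp => ?_)
    (fun p hp => ?_)
  · refine exists_rpow_le_of_volume_upper hk hb d (fun E hE hEk n hn => ?_) hp
    obtain ⟨q, hdeg, hq0, hq1, hqE⟩ := exists_chebyshev_filter hk hE.le hEk n
    have h1 := eval_zero_sq_le hS1 hSsym hgen (hfin n hn) q hdeg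
    have h2 : ∫ t, (q ^ 2).eval t ∂μ ≤
        μ.real (Set.Iic E) + (Real.cosh (n * √(E / S.card)) ^ 2)⁻¹ := by
      refine integral_le_measureReal_Iic_add hsupp (q ^ 2).continuous (by positivity) ?_ ?_
      · intro t ht _
        simpa using hq1 t ht
      · intro t ht htE
        simpa using hqE t ht htE.le
    rw [hq0, one_pow, ← hint] at h1
    refine h1.trans ?_
    have h3 : 0 ≤ μ.real (Set.Iic E) := measureReal_nonneg
    calc _ ≤ (Nat.card {x : Γ | (cayleyGraph S).dist 1 x ≤ n} : ℝ) *
          (μ.real (Set.Iic E) + (Real.cosh (n * √(E / S.card)) ^ 2)⁻¹) := by gcongr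
      _ ≤ _ := by
        gcongr
        exact (hgrowth n hn).2
  · have hK : (0 : ℝ) < 2 * S.card := by positivity
    refine exists_le_rpow_of_volume_lower (K := 2 * S.card) (a := a)
      (u := fun n => ∫ t, ((1 - (2 * S.card : ℝ)⁻¹ * t) ^ n) ^ 2 ∂μ) (by linarith) ha d
      (fun E hE hEK n hn => measureReal_Iic_le_integral_lazy_pow hK hsupp n hEK hn)
      (fun n => integral_nonneg fun t => by positivity) (fun n r hr E hE => ?_) hp
    have h1 := coeff_lazy_pow_le hS1 hSsym hSne hgen (hfin r hr) n _ rfl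
    rw [← hint, ← hint] at h1
    simp only [Polynomial.eval_mul, Polynomial.eval_pow, Polynomial.eval_sub, Polynomial.eval_one,
      Polynomial.eval_C, Polynomial.eval_X] at h1
    have h2 := integral_X_mul_lazy_pow_le hK hsupp n hE
    have hr0 : (0 : ℝ) < r := by exact_mod_cast hr
    have h3 := (hgrowth r hr).1
    refine h1.trans ?_
    gcongr
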